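/- Fix a real p ≥ 1, a natural number N ≥ 1, and dimensions n : Fin N → ℕ with n k ≥ 1 for all k. For every order-N tensor A : (Π k : Fin N, Fin (n k)) → ℝ, the nuclear p-norm ‖A‖_{p*} equals the infimum, over all CP decompositions (u_{k,i})_{k ∈ Fin N, i=1,…,r} of A, of (1/N)·∑_{i=1}^r ∑_{k ∈ Fin N} ‖u_{k,i}‖_p^N. -/

import Mathlib

open scoped BigOperators

/-- The `p`-norm `(∑ |u_j|^p)^(1/p)` of a vector in `ℝ^n`. -/
noncomputable def pNorm (p : ℝ) {n : ℕ} (u : Fin n → ℝ) : ℝ :=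
  (∑ j, |u j| ^ p) ^ (1 / p)

/-- The nuclear `p`-norm of an order-`N` tensor: the infimum, over all CP decompositions,
of the sum over rank-one terms of the product of the `p`-norms of the factors. -/
noncomputable def nuclearPNorm (p : ℝ) {N : ℕ} (n : Fin N → ℕ)
    (A : (∀ k : Fin N, Fin (n k)) → ℝ) : ℝ :=
  sInf { s : ℝ | ∃ (r : ℕ) (u : ∀ k : Fin N, Fin r → Fin (n k) → ℝ),
      (∀ x : ∀ k : Fin N, Fin (n k), A x = ∑ i, ∏ k, u k i (x k)) ∧
      s = ∑ i, ∏ k, pNorm p (u k i) }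

theorem pNorm_nonneg (p : ℝ) {n : ℕ} (u : Fin n → ℝ) : 0 ≤ pNorm p u :=
  Real.rpow_nonneg (Finset.sum_nonneg fun _ _ => Real.rpow_nonneg (abs_nonneg _) _) _

theorem pNorm_smul {p : ℝ} (hp : 0 < p) {n : ℕ} {c : ℝ} (hc : 0 ≤ c) (u : Fin n → ℝ) :
    pNorm p (c • u) = c * pNorm p u := by
  have hsum : 0 ≤ ∑ j, |u j| ^ p :=
    Finset.sum_nonneg fun _ _ => Real.rpow_nonneg (abs_nonneg _) _
  simp only [pNorm, Pi.smul_apply, smul_eq_mul, abs_mul, abs_of_nonneg hc,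
    Real.mul_rpow hc (abs_nonneg _)]
  rw [← Finset.mul_sum, Real.mul_rpow (Real.rpow_nonneg hc _) hsum, ← Real.rpow_mul hc,
    mul_one_div_cancel hp.ne', Real.rpow_one]

theorem eq_zero_of_pNorm_eq_zero {p : ℝ} (hp : 0 < p) {n : ℕ} {u : Fin n → ℝ}
    (h : pNorm p u = 0) : u = 0 := by
  have hnn : ∀ j ∈ Finset.univ, 0 ≤ |u j| ^ p := fun _ _ => Real.rpow_nonneg (abs_nonneg _) _
  have hsum := (Real.rpow_eq_zero (Finset.sum_nonneg hnn) (one_div_pos.2 hp).ne').1 h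
  funext j
  have hj := (Finset.sum_eq_zero_iff_of_nonneg hnn).1 hsum j (Finset.mem_univ j)
  exact abs_eq_zero.1 ((Real.rpow_eq_zero (abs_nonneg _) hp.ne').1 hj)

/-- The factors of a rank-one tensor can be rescaled so that all their `p`-norms agree. -/
theorem exists_balanced_factors {p : ℝ} (hp : 0 < p) {N : ℕ} (hN : N ≠ 0) {n : Fin N → ℕ}
    (v : ∀ k : Fin N, Fin (n k) → ℝ) :
    ∃ w : ∀ k : Fin N, Fin (n k) → ℝ,
      (∀ x : ∀ k : Fin N, Fin (n k), ∏ k, w k (x k) = ∏ k, v k (x k)) ∧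
      ∀ k, pNorm p (w k) ^ N = ∏ k, pNorm p (v k) := by
  have hP : 0 ≤ ∏ k, pNorm p (v k) := Finset.prod_nonneg fun k _ => pNorm_nonneg p (v k)
  set c : ℝ := (∏ k, pNorm p (v k)) ^ ((N : ℝ)⁻¹)
  have hc0 : 0 ≤ c := Real.rpow_nonneg hP _
  have hcN : c ^ N = ∏ k, pNorm p (v k) := Real.rpow_inv_natCast_pow hP hN
  by_cases h : ∏ k, pNorm p (v k) = 0
  · obtain ⟨k₀, -, hk₀⟩ := Finset.prod_eq_zero_iff.1 h
    have hv := eq_zero_of_pNorm_eq_zero hp hk₀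
    refine ⟨fun _ => 0, fun x => ?_, fun k => ?_⟩
    · rw [Finset.prod_eq_zero (Finset.mem_univ k₀) rfl,
        Finset.prod_eq_zero (Finset.mem_univ k₀) (congrFun hv _)]
    · have h0 : pNorm p (0 : Fin (n k) → ℝ) = 0 := by
        simpa using pNorm_smul hp le_rfl (0 : Fin (n k) → ℝ)
      rw [h0, h, zero_pow hN]
  · refine ⟨fun k => (c / pNorm p (v k)) • v k, fun x => ?_, fun k => ?_⟩
    · simp only [Pi.smul_apply, smul_eq_mul, Finset.prod_mul_distrib, Finset.prod_div_distrib,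
        Finset.prod_const, Finset.card_univ, Fintype.card_fin]
      rw [hcN, div_self h, one_mul]
    · rw [pNorm_smul hp (div_nonneg hc0 (pNorm_nonneg p _)),
        div_mul_cancel₀ _ (Finset.prod_ne_zero_iff.1 h k (Finset.mem_univ k)), hcN]

theorem prod_le_inv_mul_sum_pow {N : ℕ} (hN : N ≠ 0) (a : Fin N → ℝ) (ha : ∀ k, 0 ≤ a k) :
    ∏ k, a k ≤ (1 / (N : ℝ)) * ∑ k, a k ^ N := by
  have hN' : (N : ℝ) ≠ 0 := Nat.cast_ne_zero.2 hN
  have h := Real.geom_mean_le_arith_mean_weighted Finset.univ (fun _ => 1 / (N : ℝ))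
    (fun k => a k ^ N) (fun _ _ => by positivity) (by simp [hN'])
    (fun k _ => pow_nonneg (ha k) N)
  simpa only [one_div, Real.pow_rpow_inv_natCast (ha _) hN, ← Finset.mul_sum] using h

/-- The nuclear `p`-norm equals the infimum, over all CP decompositions, of
`(1/N) ∑_i ∑_k ‖u_{k,i}‖_p^N`. -/
theorem nuclearPNorm_eq_inf_power_sum (p : ℝ) (hp : 1 ≤ p) {N : ℕ} (hN : 1 ≤ N)
    (n : Fin N → ℕ) (hn : ∀ k, 1 ≤ n k) (A : (∀ k : Fin N, Fin (n k)) → ℝ) :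
    nuclearPNorm p n A
      = sInf { s : ℝ | ∃ (r : ℕ) (u : ∀ k : Fin N, Fin r → Fin (n k) → ℝ),
          (∀ x : ∀ k : Fin N, Fin (n k), A x = ∑ i, ∏ k, u k i (x k)) ∧
          s = (1 / (N : ℝ)) * ∑ i, ∑ k, pNorm p (u k i) ^ (N : ℕ) } := by
  have hp0 : 0 < p := by linarith
  have hN0 : N ≠ 0 := by omega
  have hNR : (N : ℝ) ≠ 0 := Nat.cast_ne_zero.2 hN0
  unfold nuclearPNorm
  set S := { s : ℝ | ∃ (r : ℕ) (u : ∀ k : Fin N, Fin r → Fin (n k) → ℝ),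
      (∀ x : ∀ k : Fin N, Fin (n k), A x = ∑ i, ∏ k, u k i (x k)) ∧
      s = ∑ i, ∏ k, pNorm p (u k i) }
  set T := { s : ℝ | ∃ (r : ℕ) (u : ∀ k : Fin N, Fin r → Fin (n k) → ℝ),
      (∀ x : ∀ k : Fin N, Fin (n k), A x = ∑ i, ∏ k, u k i (x k)) ∧
      s = (1 / (N : ℝ)) * ∑ i, ∑ k, pNorm p (u k i) ^ (N : ℕ) }
  have hST : S ⊆ T := by
    rintro s ⟨r, u, hA, rfl⟩
    choose w hw hwN using fun i => exists_balanced_factors hp0 hN0 fun k => u k i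
    refine ⟨r, fun k i => w i k, fun x => ?_, ?_⟩
    · simp only [hA, hw]
    · simp only [hwN, Finset.sum_const, Finset.card_univ, Fintype.card_fin, nsmul_eq_mul,
        ← Finset.mul_sum]
      rw [← mul_assoc, one_div_mul_cancel hNR, one_mul]
  have hTS : ∀ t ∈ T, ∃ s ∈ S, s ≤ t := by
    rintro t ⟨r, u, hA, rfl⟩
    refine ⟨_, ⟨r, u, hA, rfl⟩, ?_⟩
    rw [Finset.mul_sum]
    exact Finset.sum_le_sum fun i _ =>
      prod_le_inv_mul_sum_pow hN0 _ fun k => pNorm_nonneg p (u k i)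
  have hS : BddBelow S := by
    refine ⟨0, ?_⟩
    rintro s ⟨r, u, -, rfl⟩
    exact Finset.sum_nonneg fun i _ => Finset.prod_nonneg fun k _ => pNorm_nonneg p (u k i)
  have hT : BddBelow T := by
    obtain ⟨b, hb⟩ := hS
    refine ⟨b, fun t ht => ?_⟩
    obtain ⟨s, hs, hst⟩ := hTS t ht
    exact (hb hs).trans hst
  rcases T.eq_empty_or_nonempty with hTe | hTn
  · rw [Set.subset_eq_empty hST hTe, hTe]
  · obtain ⟨s, hs, -⟩ := hTS _ hTn.some_mem
    refine le_antisymm (le_csInf hTn fun t ht => ?_) (csInf_le_csInf hT ⟨s, hs⟩ hST)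
    obtain ⟨s', hs', hst⟩ := hTS t ht
    exact (csInf_le hS hs').trans hst
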